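/- Fix t₁ ∈ ℂ. For k ≥ 0 define h_k := Σ_{(i,j,l) ∈ ℕ³: i+3j+5l=k} (1/(i!·j!·l!))·(−4t₁/3)^j·(−16/5)^l·X^i ∈ ℂ[X] (equivalently, Σ_k h_k λ^k = exp(Xλ − (4/3)t₁λ³ − (16/5)λ⁵) as a formal power series in λ over ℂ[X]), and set h_k := 0 for k < 0. Let τ₀ := 1 and for m ≥ 1 let τ_m ∈ ℂ[X] be the determinant of the m × m matrix whose (i,j) entry (1 ≤ i, j ≤ m) is h_{m+j−2i+1}. Then τ_m ≠ 0 for every m ≥ 0, and for every m ≥ 1 the rational function w_m := τ_{m−1}′/τ_{m−1} − τ_m′/τ_m ∈ ℂ(X) satisfies the second member of the non-stationary second Painlevé hierarchy with parameter m: w_m⁗ − 10·w_m²·w_m″ − 10·w_m·(w_m′)² + 6·w_m⁵ + t₁·(w_m″ − 2·w_m³) = X·w_m + m. -/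

import Mathlib

open Polynomial

/-- The complete homogeneous polynomials `h_k` for the second member of the
non-stationary second Painlevé hierarchy, defined by
`Σ_k h_k λ^k = exp(Xλ − (4/3)t₁λ³ − (16/5)λ⁵)`; `h_k = 0` for `k < 0`. -/
noncomputable def painleveH2 (t₁ : ℂ) (k : ℤ) : Polynomial ℂ :=
  if k < 0 then 0
  else
    ∑ p ∈ ((Finset.range (k.toNat + 1) ×ˢ Finset.range (k.toNat + 1)) ×ˢ
          Finset.range (k.toNat + 1)).filter
        (fun p => p.1.1 + 3 * p.1.2 + 5 * p.2 = k.toNat),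
      Polynomial.C
          ((1 / ((Nat.factorial p.1.1 : ℂ) * (Nat.factorial p.1.2 : ℂ) *
              (Nat.factorial p.2 : ℂ))) *
            ((-4 : ℂ) * t₁ / 3) ^ p.1.2 * ((-16 : ℂ) / 5) ^ p.2) *
        X ^ p.1.1

/-- The Jacobi–Trudi polynomial τ-function: the `m × m` determinant with
(1-based) `(i,j)` entry `h_{m+j−2i+1}`. -/
noncomputable def painleveTau2 (t₁ : ℂ) (m : ℕ) : Polynomial ℂ :=
  Matrix.det (Matrix.of fun i j : Fin m =>
    painleveH2 t₁ ((m : ℤ) + ((j : ℕ) : ℤ) - 2 * ((i : ℕ) : ℤ)))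

section Darboux

variable {K : Type*} [Field K] (D : Derivation ℤ K K)

/-- The operator `x∂ − 4t B₃ − 16 B₅` generating scalings of the KdV hierarchy, where `B₃` and `B₅`
are the differential parts of the fractional powers `L^{3/2}` and `L^{5/2}` of `L = ∂² − u`. -/
def kdvScaling (x t u y : K) : K :=
  x * D y - t * (4 * D (D (D y)) - 6 * u * D y - 3 * D u * y) -
    (16 * D (D (D (D (D y)))) - 40 * u * D (D (D y)) - 60 * D u * D (D y) +
      (30 * u ^ 2 - 50 * D (D u)) * D y + (30 * u * D u - 15 * D (D (D u))) * y)

/-- The second member of the second Painlevé hierarchy, solved for its parameter. -/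
def painleveII2 (x t w : K) : K :=
  D (D (D (D w))) - 10 * w ^ 2 * D (D w) - 10 * w * (D w) ^ 2 + 6 * w ^ 5 +
    t * (D (D w) - 2 * w ^ 3) - x * w

/-- `ψ` is the image of the sequence `h` under a monic differential operator of order `m` that
kills `h₁, h₃, …, h_{2m-1}` and intertwines `∂²` with `∂² − u`, and it consists of
eigenfunctions of the scaling operator. -/
structure IsDressed (x t : K) (h : ℤ → K) (m : ℕ) (u : K) (ψ : ℤ → K) : Prop where
  schrodinger : ∀ k, D (D (ψ k)) = u * ψ k + ψ (k - 2)
  scaling : ∀ k : ℤ, kdvScaling D x t u (ψ k) = (k - m) * ψ k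
  neg_two : ψ (-2) = 0
  odd : ∀ i : ℕ, i ≤ m → ψ (2 * i - 1) = 0
  wronskian : ψ 0 * D (ψ (2 * m + 1)) - D (ψ 0) * ψ (2 * m + 1) ≠ 0
  monic : ∃ c : ℕ → K, c 0 = 1 ∧ (∀ j, m < j → c j = 0) ∧
    ∀ k, ψ k = ∑ j ∈ Finset.range (m + 1), c j * h (k - m + j)

theorem Derivation.map_ofNat_eq_zero (n : ℕ) [n.AtLeastTwo] : D (OfNat.ofNat n) = 0 := by
  exact_mod_cast D.map_natCast n

theorem exists_derivation_eq (f : K → K) (hadd : ∀ x y, f (x + y) = f x + f y)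
    (hmul : ∀ x y, f (x * y) = x * f y + f x * y) :
    ∃ D : Derivation ℤ K K, ∀ y, D y = f y :=
  ⟨Derivation.mk' (AddMonoidHom.mk' f hadd).toIntLinearMap fun a b => by
    simp only [AddMonoidHom.coe_toIntLinearMap, AddMonoidHom.mk'_apply, hmul, smul_eq_mul]
    ring, fun _ => rfl⟩

variable {D}

/-- Riccati form of the scaling eigenvalue equation: if `φ' = vφ`, then `−v` satisfies the second
Painlevé equation of order four. -/
theorem kdvScaling_of_logDeriv {x t v φ : K} (hφ : D φ = v * φ) :
    kdvScaling D x t (D v + v ^ 2) φ = painleveII2 D x t (-v) * φ := by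
  simp only [kdvScaling, painleveII2, hφ, map_add, map_neg, D.leibniz, pow_succ, pow_zero, one_mul,
    smul_eq_mul]
  ring

/-- Darboux covariance of the scaling operator. -/
theorem kdvScaling_darboux {x t v : K} (hx : D x = 1) (ht : D t = 0) (y : K) :
    kdvScaling D x t (D v + v ^ 2 - 2 * D v) (D y - v * y) =
      D (kdvScaling D x t (D v + v ^ 2) y) - v * kdvScaling D x t (D v + v ^ 2) y -
        D (painleveII2 D x t (-v)) * y - (D y - v * y) := by
  simp only [kdvScaling, painleveII2, hx, ht, map_add, map_sub, map_neg, D.leibniz, pow_succ,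
    pow_zero, one_mul, smul_eq_mul, D.map_ofNat_eq_zero, map_zero]
  ring

namespace IsDressed

variable {x t u : K} {h ψ : ℤ → K} {m : ℕ}

theorem seed_ne_zero (H : IsDressed D x t h m u ψ) : ψ (2 * m + 1) ≠ 0 := by
  intro h0
  apply H.wronskian
  simp [h0]

theorem seed_schrodinger (H : IsDressed D x t h m u ψ) :
    D (D (ψ (2 * m + 1))) = u * ψ (2 * m + 1) := by
  have h1 := H.schrodinger (2 * m + 1)
  rwa [show (2 * m + 1 - 2 : ℤ) = 2 * m - 1 by ring, H.odd m le_rfl, add_zero] at h1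

/-- The logarithmic derivative of the seed function solves the Riccati equation. -/
theorem riccati (H : IsDressed D x t h m u ψ) {v : K} (hv : D (ψ (2 * m + 1)) = v * ψ (2 * m + 1)) :
    u = D v + v ^ 2 := by
  have h1 := H.seed_schrodinger
  apply mul_right_cancel₀ H.seed_ne_zero
  rw [← h1, hv, D.leibniz, hv]
  simp only [smul_eq_mul]
  ring

theorem painleveII2_eq (H : IsDressed D x t h m u ψ) {v : K}
    (hv : D (ψ (2 * m + 1)) = v * ψ (2 * m + 1)) :
    painleveII2 D x t (-v) = (m + 1 : ℕ) := by
  apply mul_right_cancel₀ H.seed_ne_zero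
  rw [← kdvScaling_of_logDeriv hv, ← H.riccati hv, H.scaling]
  push_cast
  ring

theorem darboux (hx : D x = 1) (ht : D t = 0) (hh : ∀ k, D (h k) = h (k - 1))
    (H : IsDressed D x t h m u ψ) {v : K} (hv : D (ψ (2 * m + 1)) = v * ψ (2 * m + 1)) :
    IsDressed D x t h (m + 1) (u - 2 * D v) (fun k => D (ψ k) - v * ψ k) := by
  have hu := H.riccati hv
  have hD : ∀ k, D (D (ψ k) - v * ψ k) = ψ (k - 2) - v * (D (ψ k) - v * ψ k) := by
    intro k
    rw [map_sub, H.schrodinger, D.leibniz, hu]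
    simp only [smul_eq_mul]
    ring
  refine ⟨fun k => ?_, fun k => ?_, ?_, fun i hi => ?_, ?_, ?_⟩
  · rw [hD, map_sub, D.leibniz, hD, hu]
    simp only [smul_eq_mul]
    ring
  · rw [hu, kdvScaling_darboux hx ht, ← hu, H.scaling, H.painleveII2_eq hv, D.leibniz]
    simp
    ring
  · simp [H.neg_two]
  · rcases Nat.lt_or_ge m i with h1 | h1
    · obtain rfl : i = m + 1 := by omega
      rw [show (2 * ((m + 1 : ℕ) : ℤ) - 1) = 2 * m + 1 by push_cast; ring, hv, sub_self]
    · simp [H.odd i h1]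
  · have h1 := H.wronskian
    rw [hD, hD, show (2 * ((m + 1 : ℕ) : ℤ) + 1 - 2) = 2 * m + 1 by push_cast; ring, zero_sub,
      H.neg_two]
    rw [hv] at h1
    intro h2
    apply h1
    linear_combination -h2
  · obtain ⟨c, c0, cm, hc⟩ := H.monic
    refine ⟨fun j => c j + if j = 0 then 0 else D (c (j - 1)) - v * c (j - 1), by simp [c0],
      fun j hj => ?_, fun k => ?_⟩
    · simp [cm j (by omega), cm (j - 1) (by omega)]
    · have h1 : ∑ j ∈ Finset.range (m + 2), c j * h (k - (m + 1 : ℕ) + j) =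
          ∑ j ∈ Finset.range (m + 1), c j * h (k - m + j - 1) := by
        rw [Finset.sum_range_succ, cm (m + 1) (by omega), zero_mul, add_zero]
        refine Finset.sum_congr rfl fun j _ => ?_
        congr 2
        push_cast
        ring
      simp only [add_mul, Finset.sum_add_distrib]
      rw [h1, Finset.sum_range_succ' _ (m + 1), hc, map_sum, Finset.mul_sum]
      simp only [if_true, zero_mul, add_zero, ← Finset.sum_add_distrib, ← Finset.sum_sub_distrib]
      refine Finset.sum_congr rfl fun j _ => ?_
      rw [D.leibniz, hh, if_neg (Nat.succ_ne_zero j), Nat.add_sub_cancel,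
        show k - ((m + 1 : ℕ) : ℤ) + ((j + 1 : ℕ) : ℤ) = k - m + j by push_cast; ring]
      simp only [smul_eq_mul]
      ring

/-- The Jacobi–Trudi determinants factor through the seed functions. -/
theorem det_succ (H : IsDressed D x t h m u ψ) :
    (Matrix.of fun i j : Fin (m + 1) => h ((m + 1 : ℕ) + (j : ℕ) - 2 * (i : ℕ))).det =
      (Matrix.of fun i j : Fin m => h (m + (j : ℕ) - 2 * (i : ℕ))).det * ψ (2 * m + 1) := by
  obtain ⟨c, c0, -, hc⟩ := H.monic
  set A := Matrix.of fun i j : Fin (m + 1) => h ((m + 1 : ℕ) + (j : ℕ) - 2 * (i : ℕ)) with hA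
  have hcol : ∀ i : Fin (m + 1),
      ∑ j : Fin (m + 1), c j • A i j = ψ (2 * m + 1 - 2 * (i : ℕ)) := by
    intro i
    rw [hc, ← Fin.sum_univ_eq_sum_range (fun j => c j * h (2 * m + 1 - 2 * (i : ℕ) - m + j))]
    refine Finset.sum_congr rfl fun j _ => ?_
    simp only [hA, Matrix.of_apply, smul_eq_mul]
    congr 2
    push_cast
    ring
  have hdet := Matrix.det_updateCol_sum A 0 (fun j => c j)
  rw [Fin.val_zero, c0, one_smul] at hdet
  simp only [hcol] at hdet
  rw [← hdet, Matrix.det_succ_column_zero, Fin.sum_univ_succ, Finset.sum_eq_zero, add_zero]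
  · simp only [Matrix.updateCol_self]
    rw [mul_comm]
    simp only [Fin.val_zero, pow_zero, one_mul, Nat.cast_zero, mul_zero, sub_zero]
    congr 2
    ext i j
    simp only [hA, Matrix.submatrix_apply, Matrix.of_apply]
    rw [Matrix.updateCol_ne (Fin.succ_ne_zero j)]
    simp only [Matrix.of_apply, Fin.succAbove_zero, Fin.val_succ]
    congr 1
    push_cast
    ring
  · intro i _
    have h0 : ψ (2 * m + 1 - 2 * (i.succ : ℕ)) = 0 := by
      have h1 := H.odd (m - i) (by omega)
      rw [← h1]
      congr 1
      have := i.2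
      simp only [Fin.val_succ]
      omega
    simp only [Matrix.updateCol_self, h0, mul_zero, zero_mul]

/-- Iterated Darboux transformations starting from the free Schrödinger operator. -/
theorem exists_dressed (hx : D x = 1) (ht : D t = 0) (hh : ∀ k, D (h k) = h (k - 1))
    (hneg : ∀ k < 0, h k = 0) (h0 : h 0 = 1)
    (hrec : ∀ k : ℤ, x * h (k - 1) - 4 * t * h (k - 3) - 16 * h (k - 5) = k * h k) (m : ℕ) :
    ∃ u ψ, IsDressed D x t h m u ψ := by
  induction m with
  | zero =>
    refine ⟨0, h, fun k => ?_, fun k => ?_, hneg _ (by norm_num), fun i hi => ?_, ?_,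
      fun j => if j = 0 then 1 else 0, by simp, fun j hj => by simp; omega, fun k => by simp⟩
    · rw [hh, hh, zero_mul, zero_add]
      congr 1
      ring
    · simp only [kdvScaling, hh, map_zero]
      rw [show k - 1 - 1 - 1 - 1 - 1 = k - 5 by ring, show k - 1 - 1 - 1 = k - 3 by ring]
      push_cast
      linear_combination hrec k
    · obtain rfl : i = 0 := by omega
      exact hneg _ (by norm_num)
    · simp [hh, h0]
  | succ m ih =>
    obtain ⟨u, ψ, H⟩ := ih
    exact ⟨_, _, H.darboux hx ht hh (v := D (ψ (2 * m + 1)) / ψ (2 * m + 1))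
      (div_mul_cancel₀ _ H.seed_ne_zero).symm⟩

end IsDressed

end Darboux

section PainleveH2

/-- The divided power `zᵏ / k!`, extended by zero to negative exponents. -/
noncomputable def dividedMonomial (k : ℤ) : ℂ[X] :=
  if k < 0 then 0 else C (1 / (k.toNat.factorial : ℂ)) * X ^ k.toNat

theorem dividedMonomial_natCast (n : ℕ) :
    dividedMonomial n = C (1 / (n.factorial : ℂ)) * X ^ n := by
  simp [dividedMonomial]

theorem dividedMonomial_of_neg {k : ℤ} (hk : k < 0) : dividedMonomial k = 0 := if_pos hk

theorem X_mul_dividedMonomial (k : ℤ) :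
    X * dividedMonomial (k - 1) = (k : ℂ[X]) * dividedMonomial k := by
  rcases lt_trichotomy k 0 with hk | rfl | hk
  · rw [dividedMonomial_of_neg hk, dividedMonomial_of_neg (by omega), mul_zero, mul_zero]
  · rw [dividedMonomial_of_neg (by omega), mul_zero, Int.cast_zero, zero_mul]
  · obtain ⟨n, rfl⟩ : ∃ n : ℕ, k = n + 1 := ⟨(k - 1).toNat, by omega⟩
    have hn : (n.factorial : ℂ) ≠ 0 := by exact_mod_cast n.factorial_ne_zero
    have hn1 : (n + 1 : ℂ) ≠ 0 := by exact_mod_cast n.succ_ne_zero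
    have hC : C (1 / (n.factorial : ℂ)) = (n + 1 : ℂ[X]) * C (1 / ((n + 1).factorial : ℂ)) := by
      rw [show (n + 1 : ℂ[X]) = C (n + 1 : ℂ) by simp, ← C_mul, Nat.factorial_succ]
      congr 1
      push_cast
      field_simp
    rw [add_sub_cancel_right, dividedMonomial_natCast, hC]
    have := dividedMonomial_natCast (n + 1)
    push_cast at this ⊢
    rw [this]
    ring

theorem derivative_dividedMonomial (k : ℤ) :
    derivative (dividedMonomial k) = dividedMonomial (k - 1) := by
  rcases lt_trichotomy k 0 with hk | rfl | hk
  · rw [dividedMonomial_of_neg hk, dividedMonomial_of_neg (by omega), derivative_zero]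
  · simp [dividedMonomial]
  · apply mul_left_cancel₀ (X_ne_zero (R := ℂ))
    rw [X_mul_dividedMonomial]
    obtain ⟨n, rfl⟩ : ∃ n : ℕ, k = n + 1 := ⟨(k - 1).toNat, by omega⟩
    have := dividedMonomial_natCast (n + 1)
    push_cast at this ⊢
    rw [this, derivative_C_mul_X_pow, C_mul, C_eq_natCast, Nat.add_sub_cancel]
    push_cast
    ring

/-- The `j`-th Taylor coefficient of `exp(zλ)`. -/
noncomputable def timeCoeff (z : ℂ) (j : ℕ) : ℂ := z ^ j / (j.factorial : ℂ)

theorem succ_mul_timeCoeff (z : ℂ) (j : ℕ) :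
    ((j + 1 : ℕ) : ℂ) * timeCoeff z (j + 1) = z * timeCoeff z j := by
  have hn : (j.factorial : ℂ) ≠ 0 := by exact_mod_cast j.factorial_ne_zero
  have hn1 : (j + 1 : ℂ) ≠ 0 := by exact_mod_cast j.succ_ne_zero
  rw [timeCoeff, timeCoeff, Nat.factorial_succ]
  push_cast
  field_simp
  ring

variable (t₁ : ℂ)

theorem painleveH2_summand (i j l : ℕ) :
    C (1 / ((i.factorial : ℂ) * (j.factorial : ℂ) * (l.factorial : ℂ)) * ((-4 : ℂ) * t₁ / 3) ^ j *
        ((-16 : ℂ) / 5) ^ l) * X ^ i =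
      C (timeCoeff (-4 * t₁ / 3) j * timeCoeff (-16 / 5) l) * dividedMonomial i := by
  rw [dividedMonomial_natCast, ← mul_assoc, ← C_mul, timeCoeff, timeCoeff]
  congr 2
  field_simp

theorem painleveH2_eq_sum {k : ℤ} {N M : ℕ} (hN : k < N) (hM : k < M) :
    painleveH2 t₁ k = ∑ j ∈ Finset.range N, ∑ l ∈ Finset.range M,
      C (timeCoeff (-4 * t₁ / 3) j * timeCoeff (-16 / 5) l) *
        dividedMonomial (k - 3 * j - 5 * l) := by
  rw [painleveH2]
  split_ifs with hk
  · refine (Finset.sum_eq_zero fun j _ => Finset.sum_eq_zero fun l _ => ?_).symm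
    rw [dividedMonomial_of_neg (by omega), mul_zero]
  · obtain ⟨n, rfl⟩ : ∃ n : ℕ, k = n := ⟨k.toNat, by omega⟩
    rw [← Finset.sum_product']
    symm
    rw [Int.toNat_natCast]
    refine Finset.sum_bij_ne_zero (fun p _ _ => ((n - 3 * p.1 - 5 * p.2, p.1), p.2)) ?_ ?_ ?_ ?_
    · rintro ⟨j, l⟩ - hne
      have hle : ¬ ((n : ℤ) - 3 * j - 5 * l < 0) := fun hlt => hne (by
        simp only [dividedMonomial_of_neg hlt, mul_zero])
      simp only [Finset.mem_filter, Finset.mem_product, Finset.mem_range]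
      omega
    · rintro ⟨j, l⟩ - - ⟨j', l'⟩ - - heq
      simp only [Prod.mk.injEq] at heq
      ext <;> simp [heq]
    · rintro ⟨⟨i, j⟩, l⟩ hmem hne
      simp only [Finset.mem_filter, Finset.mem_product, Finset.mem_range] at hmem
      have hi : (n : ℤ) - 3 * j - 5 * l = i := by omega
      refine ⟨(j, l), ?_, ?_, ?_⟩
      · simp only [Finset.mem_product, Finset.mem_range]
        omega
      · rwa [hi, ← painleveH2_summand]
      · simp only [Prod.mk.injEq, and_true]
        omega
    · rintro ⟨j, l⟩ - hne
      have hle : ¬ ((n : ℤ) - 3 * j - 5 * l < 0) := fun hlt => hne (by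
        simp only [dividedMonomial_of_neg hlt, mul_zero])
      have hi : (n : ℤ) - 3 * j - 5 * l = (n - 3 * j - 5 * l : ℕ) := by omega
      rw [hi, painleveH2_summand]

theorem painleveH2_of_neg {k : ℤ} (hk : k < 0) : painleveH2 t₁ k = 0 := if_pos hk

theorem painleveH2_zero : painleveH2 t₁ 0 = 1 := by
  rw [painleveH2_eq_sum t₁ (N := 1) (M := 1) (by norm_num) (by norm_num)]
  simp [timeCoeff, dividedMonomial]

theorem derivative_painleveH2 (k : ℤ) :
    derivative (painleveH2 t₁ k) = painleveH2 t₁ (k - 1) := by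
  have hN : k < (k.toNat + 1 : ℕ) := by omega
  have hN' : k - 1 < (k.toNat + 1 : ℕ) := by omega
  rw [painleveH2_eq_sum t₁ hN hN, painleveH2_eq_sum t₁ hN' hN']
  simp only [derivative_sum, derivative_C_mul, derivative_dividedMonomial]
  refine Finset.sum_congr rfl fun j _ => Finset.sum_congr rfl fun l _ => ?_
  congr 2
  ring

theorem painleveH2_recurrence (k : ℤ) :
    X * painleveH2 t₁ (k - 1) - 4 * C t₁ * painleveH2 t₁ (k - 3) - 16 * painleveH2 t₁ (k - 5) =
      (k : ℂ[X]) * painleveH2 t₁ k := by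
  set N := k.toNat + 1 with hNdef
  have h1 : (k : ℂ[X]) * painleveH2 t₁ k = X * painleveH2 t₁ (k - 1) +
      ∑ j ∈ Finset.range (N + 1), ∑ l ∈ Finset.range (N + 1), C (3 * (j * timeCoeff (-4 * t₁ / 3) j)
        * timeCoeff (-16 / 5) l) * dividedMonomial (k - 3 * j - 5 * l) +
      ∑ j ∈ Finset.range (N + 1), ∑ l ∈ Finset.range (N + 1), C (5 * (l * timeCoeff (-16 / 5) l)
        * timeCoeff (-4 * t₁ / 3) j) * dividedMonomial (k - 3 * j - 5 * l) := by
    rw [painleveH2_eq_sum t₁ (k := k) (N := N + 1) (M := N + 1) (by omega) (by omega),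
      painleveH2_eq_sum t₁ (k := k - 1) (N := N + 1) (M := N + 1) (by omega) (by omega)]
    simp only [Finset.mul_sum, ← Finset.sum_add_distrib]
    refine Finset.sum_congr rfl fun j _ => Finset.sum_congr rfl fun l _ => ?_
    have h2 := X_mul_dividedMonomial (k - 3 * j - 5 * l)
    rw [show k - 3 * j - 5 * l - 1 = k - 1 - 3 * j - 5 * l by ring] at h2
    simp only [C_mul, C_eq_natCast, map_ofNat]
    push_cast at h2
    linear_combination -(C (timeCoeff (-4 * t₁ / 3) j) * C (timeCoeff (-16 / 5) l)) * h2
  have h3 : ∑ j ∈ Finset.range (N + 1), ∑ l ∈ Finset.range (N + 1),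
      C (3 * (j * timeCoeff (-4 * t₁ / 3) j) * timeCoeff (-16 / 5) l) *
        dividedMonomial (k - 3 * j - 5 * l) = -(4 * C t₁ * painleveH2 t₁ (k - 3)) := by
    rw [painleveH2_eq_sum t₁ (k := k - 3) (N := N) (M := N + 1) (by omega) (by omega),
      Finset.sum_range_succ']
    simp only [succ_mul_timeCoeff, Finset.mul_sum, ← Finset.sum_neg_distrib]
    simp only [Nat.cast_zero, zero_mul, mul_zero, C_0, Finset.sum_const_zero, add_zero]
    refine Finset.sum_congr rfl fun j _ => Finset.sum_congr rfl fun l _ => ?_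
    rw [show k - 3 * ((j + 1 : ℕ) : ℤ) - 5 * l = k - 3 - 3 * j - 5 * l by push_cast; ring,
      show 3 * (-4 * t₁ / 3 * timeCoeff (-4 * t₁ / 3) j) * timeCoeff (-16 / 5) l =
        -(4 * t₁ * (timeCoeff (-4 * t₁ / 3) j * timeCoeff (-16 / 5) l)) by ring]
    simp only [C_mul, C_neg, map_ofNat]
    ring
  have h4 : ∑ j ∈ Finset.range (N + 1), ∑ l ∈ Finset.range (N + 1),
      C (5 * (l * timeCoeff (-16 / 5) l) * timeCoeff (-4 * t₁ / 3) j) *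
        dividedMonomial (k - 3 * j - 5 * l) = -(16 * painleveH2 t₁ (k - 5)) := by
    rw [painleveH2_eq_sum t₁ (k := k - 5) (N := N + 1) (M := N) (by omega) (by omega)]
    simp only [Finset.mul_sum, ← Finset.sum_neg_distrib]
    refine Finset.sum_congr rfl fun j _ => ?_
    rw [Finset.sum_range_succ']
    simp only [succ_mul_timeCoeff]
    simp only [Nat.cast_zero, zero_mul, mul_zero, C_0, add_zero]
    refine Finset.sum_congr rfl fun l _ => ?_
    rw [show k - 3 * (j : ℤ) - 5 * ((l + 1 : ℕ) : ℤ) = k - 5 - 3 * j - 5 * l by push_cast; ring,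
      show 5 * (-16 / 5 * timeCoeff (-16 / 5) l) * timeCoeff (-4 * t₁ / 3) j =
        -(16 * (timeCoeff (-4 * t₁ / 3) j * timeCoeff (-16 / 5) l)) by ring]
    simp only [C_mul, C_neg, map_ofNat]
    ring
  rw [h1, h3, h4]
  ring

end PainleveH2

/-- The polynomial τ-functions are nonzero and produce rational solutions of
the second member of the non-stationary second Painlevé hierarchy with
parameter `m`. -/
theorem PII2_rational_solutions_from_tau (t₁ : ℂ)
    (D : RatFunc ℂ → RatFunc ℂ)
    (hD_add : ∀ x y : RatFunc ℂ, D (x + y) = D x + D y)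
    (hD_mul : ∀ x y : RatFunc ℂ, D (x * y) = x * D y + D x * y)
    (hD_poly : ∀ p : Polynomial ℂ,
      D (algebraMap (Polynomial ℂ) (RatFunc ℂ) p) =
        algebraMap (Polynomial ℂ) (RatFunc ℂ) (derivative p)) :
    (∀ m : ℕ, painleveTau2 t₁ m ≠ 0) ∧
    ∀ m : ℕ, 1 ≤ m →
      let w : RatFunc ℂ :=
        algebraMap (Polynomial ℂ) (RatFunc ℂ)
              (derivative (painleveTau2 t₁ (m - 1))) /
            algebraMap (Polynomial ℂ) (RatFunc ℂ) (painleveTau2 t₁ (m - 1)) -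
          algebraMap (Polynomial ℂ) (RatFunc ℂ) (derivative (painleveTau2 t₁ m)) /
            algebraMap (Polynomial ℂ) (RatFunc ℂ) (painleveTau2 t₁ m)
      D (D (D (D w))) - 10 * w ^ 2 * D (D w) - 10 * w * (D w) ^ 2 + 6 * w ^ 5 +
          RatFunc.C t₁ * (D (D w) - 2 * w ^ 3) =
        RatFunc.X * w + (m : RatFunc ℂ) := by
  obtain ⟨d, hd⟩ := exists_derivation_eq D hD_add hD_mul
  simp only [← hd] at hD_poly ⊢
  set ι := algebraMap ℂ[X] (RatFunc ℂ) with hι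
  have hdress := IsDressed.exists_dressed (D := d) (x := RatFunc.X) (t := RatFunc.C t₁)
    (h := fun k => ι (painleveH2 t₁ k))
    (by rw [← RatFunc.algebraMap_X, hD_poly, derivative_X, map_one])
    (by rw [← RatFunc.algebraMap_C, hD_poly, derivative_C, map_zero])
    (fun k => by rw [hD_poly, derivative_painleveH2])
    (fun k hk => by rw [painleveH2_of_neg t₁ hk, map_zero])
    (by rw [painleveH2_zero, map_one])
    (fun k => by
      have h1 := congrArg ι (painleveH2_recurrence t₁ k)
      simpa [hι, RatFunc.algebraMap_X, RatFunc.algebraMap_C, map_ofNat (algebraMap ℂ[X] (RatFunc ℂ))] using h1)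
  have hdet : ∀ m, ι (painleveTau2 t₁ m) = (Matrix.of fun i j : Fin m =>
      ι (painleveH2 t₁ (m + (j : ℕ) - 2 * (i : ℕ)))).det := fun m => by
    rw [painleveTau2, RingHom.map_det]
    rfl
  have hτ : ∀ m, ι (painleveTau2 t₁ m) ≠ 0 := by
    intro m
    induction m with
    | zero => simp [hdet]
    | succ m ih =>
      obtain ⟨u, ψ, H⟩ := hdress m
      rw [hdet, H.det_succ, ← hdet]
      exact mul_ne_zero ih H.seed_ne_zero
  refine ⟨fun m h0 => hτ m (by rw [h0, map_zero]), fun m hm => ?_⟩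
  obtain ⟨m, rfl⟩ := Nat.exists_eq_add_of_le' hm
  obtain ⟨u, ψ, H⟩ := hdress m
  have hφ := H.seed_ne_zero
  have hfac : ι (painleveTau2 t₁ (m + 1)) = ι (painleveTau2 t₁ m) * ψ (2 * m + 1) := by
    rw [hdet, H.det_succ, ← hdet]
  set w := ι (derivative (painleveTau2 t₁ (m + 1 - 1))) / ι (painleveTau2 t₁ (m + 1 - 1)) -
    ι (derivative (painleveTau2 t₁ (m + 1))) / ι (painleveTau2 t₁ (m + 1)) with hw_def
  have hw : d (ψ (2 * m + 1)) = -w * ψ (2 * m + 1) := by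
    have h0 := hτ m
    have hmul : d (ι (painleveTau2 t₁ m) * ψ (2 * m + 1)) =
        ι (painleveTau2 t₁ m) * d (ψ (2 * m + 1)) + d (ι (painleveTau2 t₁ m)) * ψ (2 * m + 1) := by
      simp only [hd, hD_mul]
    simp only [hw_def, Nat.add_sub_cancel, ← hD_poly, hfac, hmul]
    field_simp
    ring
  have h1 := H.painleveII2_eq hw
  rw [neg_neg, painleveII2] at h1
  linear_combination h1
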